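/- Existence of bound universal states for the qutrit: there exists a matrix ρ : Matrix (ZMod 3) (ZMod 3) ℂ such that ρ is positive semidefinite, trace(ρ) = 1, Re(trace(A_u * ρ)) ≥ 0 for every u ∈ ZMod 3 × ZMod 3, and yet ρ does not lie in the convex hull (over ℝ, in Matrix (ZMod 3) (ZMod 3) ℂ viewed as a real vector space) of the set of rank-one projectors with everywhere-nonnegative Wigner function, i.e. the set { P | ∃ v : ZMod 3 → ℂ, Σ_x ‖v x‖² = 1 ∧ P = v vᴴ ∧ ∀ w, Re(trace(A_w * P)) ≥ 0 }. -/

import Mathlib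

open Matrix Complex

/-- ω = exp(2πi/d). -/
noncomputable def omegaC (d : ℕ) : ℂ := Complex.exp (2 * Real.pi * Complex.I / d)

/-- The clock matrix `Z`, with `Z x x = ω ^ x.val`. -/
noncomputable def Zmat (d : ℕ) : Matrix (ZMod d) (ZMod d) ℂ :=
  Matrix.diagonal (fun x => omegaC d ^ x.val)

/-- The shift matrix `X`, with `X x y = 1` iff `x = y + 1`. -/
noncomputable def Xmat (d : ℕ) : Matrix (ZMod d) (ZMod d) ℂ :=
  Matrix.of fun x y => if x = y + 1 then 1 else 0

/-- The Heisenberg–Weyl operator `T_a`. -/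
noncomputable def TW (d : ℕ) [NeZero d] (a : ZMod d × ZMod d) : Matrix (ZMod d) (ZMod d) ℂ :=
  omegaC d ^ ((-((2 : ZMod d)⁻¹ * a.1 * a.2)).val) • (Zmat d ^ a.1.val * Xmat d ^ a.2.val)

/-- The phase point operator at the origin, `A_0 = (1/d) • ∑ a, T_a`. -/
noncomputable def Apoint0 (d : ℕ) [NeZero d] : Matrix (ZMod d) (ZMod d) ℂ :=
  (1 / (d : ℂ)) • ∑ a : ZMod d × ZMod d, TW d a

/-- The phase point operator `A_u = T_u * A_0 * T_uᴴ`. -/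
noncomputable def Apoint (d : ℕ) [NeZero d] (u : ZMod d × ZMod d) : Matrix (ZMod d) (ZMod d) ℂ :=
  TW d u * Apoint0 d * (TW d u)ᴴ

lemma omegaC_three_eq :
    omegaC 3 = Complex.exp (((Real.pi - Real.pi / 3 : ℝ) : ℂ) * Complex.I) := by
  rw [omegaC]
  congr 1
  push_cast
  ring

lemma omegaC_three_re : (omegaC 3).re = -1 / 2 := by
  rw [omegaC_three_eq, Complex.exp_ofReal_mul_I_re, Real.cos_pi_sub, Real.cos_pi_div_three]
  norm_num

lemma omegaC_three_im : (omegaC 3).im = √3 / 2 := by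
  rw [omegaC_three_eq, Complex.exp_ofReal_mul_I_im, Real.sin_pi_sub, Real.sin_pi_div_three]

lemma omegaC_three_sq : omegaC 3 ^ 2 = -1 - omegaC 3 := by
  have h : √3 * √3 = 3 := Real.mul_self_sqrt (by norm_num)
  apply Complex.ext
  · simp only [pow_two, Complex.mul_re, Complex.sub_re, Complex.neg_re, Complex.one_re,
      omegaC_three_re, omegaC_three_im]
    linarith
  · simp only [pow_two, Complex.mul_im, Complex.sub_im, Complex.neg_im, Complex.one_im,
      omegaC_three_re, omegaC_three_im]
    ring

lemma omegaC_three_cube : omegaC 3 ^ 3 = 1 := by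
  linear_combination (omegaC 3 - 1) * omegaC_three_sq

lemma star_omegaC_three : (starRingEnd ℂ) (omegaC 3) = omegaC 3 ^ 2 := by
  rw [omegaC_three_sq]
  apply Complex.ext
  · simp [omegaC_three_re]; norm_num
  · simp

lemma Zmat_pow_mul_Xmat_pow (m : ℕ) (b x y : ZMod 3) :
    (Zmat 3 ^ m * Xmat 3 ^ b.val) x y = if x = y + b then omegaC 3 ^ (x.val * m) else 0 := by
  have hX : ∀ n : ℕ, ∀ x y : ZMod 3, (Xmat 3 ^ n) x y = if x = y + n then 1 else 0 := by
    intro n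
    induction n with
    | zero => intro x y; simp [Matrix.one_apply]
    | succ n ih =>
      intro x y
      rw [pow_succ, Matrix.mul_apply]
      simp only [ih]
      simp only [Xmat, Matrix.of_apply, mul_ite, mul_one, mul_zero, Finset.sum_ite_eq',
        Finset.mem_univ, if_true]
      rw [Nat.cast_succ, add_assoc, add_comm (1 : ZMod 3)]
  rw [Zmat, Matrix.diagonal_pow, Matrix.diagonal_mul, hX]
  simp [pow_mul]

lemma TW_three_apply (a b x y : ZMod 3) :
    TW 3 (a, b) x y = if x = y + b then omegaC 3 ^ (a.val * (b.val + x.val)) else 0 := by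
  have hinv : (2 : ZMod 3)⁻¹ = 2 := inv_eq_of_mul_eq_one_right (by decide)
  have hphase : -((2 : ZMod 3)⁻¹ * a * b) = a * b := by rw [hinv]; decide +revert
  rw [TW, Matrix.smul_apply, Zmat_pow_mul_Xmat_pow, hphase, ZMod.val_mul,
    ← pow_eq_pow_mod _ omegaC_three_cube, smul_eq_mul, mul_ite, mul_zero, ← pow_add]
  congr 2
  ring

lemma sum_zmod_three {M : Type*} [AddCommMonoid M] (f : ZMod 3 → M) :
    ∑ x, f x = f 0 + f 1 + f 2 :=
  Fin.sum_univ_three f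

lemma Apoint0_three_apply (x y : ZMod 3) :
    Apoint0 3 x y = if x + y = 0 then 1 else 0 := by
  have hsub (b : ZMod 3) : x = y + b ↔ b = x - y := by grind
  have hval : x + y = 0 ↔ 3 ∣ (x - y).val + x.val := by decide +revert
  simp only [Apoint0, Matrix.smul_apply, Matrix.sum_apply, TW_three_apply, hsub,
    Fintype.sum_prod_type, Finset.sum_ite_eq', Finset.mem_univ, if_true, smul_eq_mul, hval]
  generalize (x - y).val + x.val = n
  rw [sum_zmod_three, show (0 : ZMod 3).val = 0 from rfl, show (1 : ZMod 3).val = 1 from rfl,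
    show (2 : ZMod 3).val = 2 from rfl]
  simp only [Nat.dvd_iff_mod_eq_zero, mul_comm _ n, pow_mul]
  rw [pow_eq_pow_mod n omegaC_three_cube]
  have hn : n % 3 < 3 := Nat.mod_lt _ (by norm_num)
  generalize n % 3 = r at hn
  interval_cases r
  · norm_num
  · norm_num [omegaC_three_sq]
  · norm_num
    linear_combination (omegaC 3 ^ 2 - omegaC 3 + 1) * omegaC_three_sq

/-- The phase point operator `A_(p,q)` is the reflection about `q` twisted by the character `p`. -/
lemma trace_Apoint_three_mul (p q : ZMod 3) (P : Matrix (ZMod 3) (ZMod 3) ℂ) :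
    (Apoint 3 (p, q) * P).trace = P q q + omegaC 3 ^ (2 * p.val) * P (q - 1) (q + 1)
      + omegaC 3 ^ p.val * P (q + 1) (q - 1) := by
  have hc : (omegaC 3 ^ p.val) ^ 3 = 1 := by
    rw [← pow_mul, mul_comm, pow_mul, omegaC_three_cube, one_pow]
  have hA (x y : ZMod 3) : Apoint 3 (p, q) x y =
      if y = 2 * q - x then (omegaC 3 ^ p.val) ^ (x - y).val else 0 := by
    have hsub (x y b : ZMod 3) : x = y + b ↔ y = x - b := by grind
    have hneg (t : ZMod 3) : t + (y - q) = 0 ↔ t = q - y := by grind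
    have hrefl : q - y = x - q ↔ y = 2 * q - x := by grind
    have hexp : (x - y).val = (3 * q.val + x.val + 2 * y.val) % 3 := by decide +revert
    simp only [Apoint, Matrix.mul_apply, Matrix.conjTranspose_apply, TW_three_apply,
      Apoint0_three_apply, hsub, hneg, hrefl, ite_mul, zero_mul, Finset.sum_ite_eq',
      Finset.mem_univ, if_true, mul_ite, mul_one, mul_zero, apply_ite star, star_zero, star_pow,
      Complex.star_def, star_omegaC_three]
    rw [hexp, ← pow_eq_pow_mod _ hc]
    congr 1
    ring
  rw [mul_comm 2 p.val, pow_mul]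
  have hsum : (Apoint 3 (p, q) * P).trace =
      ∑ t, (omegaC 3 ^ p.val) ^ (2 * t).val * P (q - t) (q + t) := by
    simp only [Matrix.trace, Matrix.diag_apply, Matrix.mul_apply, hA, ite_mul, zero_mul,
      Finset.sum_ite_eq', Finset.mem_univ, if_true]
    rw [← Equiv.sum_comp (Equiv.addLeft q)]
    refine Finset.sum_congr rfl fun t _ => ?_
    rw [Equiv.coe_addLeft, show q + t - (2 * q - (q + t)) = 2 * t by ring,
      show 2 * q - (q + t) = q - t by ring]
  rw [hsum, sum_zmod_three, show (2 * 0 : ZMod 3).val = 0 from rfl,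
    show (2 * 1 : ZMod 3).val = 2 from rfl, show (2 * 2 : ZMod 3).val = 1 from rfl,
    show q - 2 = q + 1 from (by decide : ∀ q : ZMod 3, q - 2 = q + 1) q,
    show q + 2 = q - 1 from (by decide : ∀ q : ZMod 3, q + 2 = q - 1) q, sub_zero, add_zero, pow_zero, one_mul, pow_one]

/-- If `N + 2 Re (ω ^ p c) ≥ 0` for the three cube roots of unity, then `‖c‖ ≤ N`. -/
lemma norm_le_of_forall_re_nonneg {N : ℝ} {c : ℂ} (h0 : 0 ≤ N + 2 * c.re)
    (h1 : 0 ≤ N + 2 * (omegaC 3 * c).re) (h2 : 0 ≤ N + 2 * (omegaC 3 ^ 2 * c).re) : ‖c‖ ≤ N := by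
  have h : √3 * √3 = 3 := Real.mul_self_sqrt (by norm_num)
  rw [omegaC_three_sq] at h2
  simp only [Complex.mul_re, Complex.sub_re, Complex.neg_re, Complex.one_re, Complex.sub_im,
    Complex.neg_im, Complex.one_im, omegaC_three_re, omegaC_three_im] at h1 h2
  apply abs_le_of_sq_le_sq' _ (by linarith) |>.2
  rw [Complex.sq_norm, Complex.normSq_apply]
  have e := add_nonneg (add_nonneg (mul_nonneg h0 h1) (mul_nonneg h0 h2)) (mul_nonneg h1 h2)
  have : c.im * c.im * (√3 * √3) = c.im * c.im * 3 := by rw [h]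
  linarith

section NonnegWigner

variable {v : ZMod 3 → ℂ}

lemma re_trace_Apoint_three_vecMulVec (p q : ZMod 3) (v : ZMod 3 → ℂ) :
    ((Apoint 3 (p, q) * Matrix.vecMulVec v (star v)).trace).re =
      ‖v q‖ ^ 2 + 2 * (omegaC 3 ^ p.val * (v (q + 1) * star (v (q - 1)))).re := by
  have hconj : omegaC 3 ^ (2 * p.val) * (v (q - 1) * star (v (q + 1))) =
      (starRingEnd ℂ) (omegaC 3 ^ p.val * (v (q + 1) * star (v (q - 1)))) := by
    simp only [map_mul, map_pow, star_omegaC_three, Complex.star_def, Complex.conj_conj, pow_mul]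
    ring
  rw [trace_Apoint_three_mul]
  simp only [Matrix.vecMulVec_apply, Pi.star_apply]
  rw [hconj, Complex.add_re, Complex.add_re, Complex.conj_re, Complex.star_def, Complex.mul_conj,
    Complex.ofReal_re, Complex.normSq_eq_norm_sq]
  ring

/-- A vector with nonnegative Wigner function has `‖v (q+1)‖ ‖v (q-1)‖ ≤ ‖v q‖ ^ 2`. -/
lemma norm_mul_norm_le_sq
    (hv : ∀ w : ZMod 3 × ZMod 3, 0 ≤ ((Apoint 3 w * Matrix.vecMulVec v (star v)).trace).re)
    (q : ZMod 3) : ‖v (q + 1)‖ * ‖v (q - 1)‖ ≤ ‖v q‖ ^ 2 := by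
  have h (p : ZMod 3) := re_trace_Apoint_three_vecMulVec p q v ▸ hv (p, q)
  rw [← norm_star (v (q - 1)), ← norm_mul]
  apply norm_le_of_forall_re_nonneg
  · simpa using h 0
  · simpa [ZMod.val_one] using h 1
  · simpa [show (2 : ZMod 3).val = 2 from rfl] using h 2

/-- The witness functional `P ↦ P 0 0 + 2 Re (P 0 1)` is nonnegative on pure states with
nonnegative Wigner function. -/
lemma witness_nonneg
    (hv : ∀ w : ZMod 3 × ZMod 3, 0 ≤ ((Apoint 3 w * Matrix.vecMulVec v (star v)).trace).re) :
    0 ≤ ‖v 0‖ ^ 2 + 2 * (v 0 * star (v 1)).re := by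
  rcases eq_or_ne (v 0) 0 with h | h
  · simp [h]
  have ha : 0 < ‖v 0‖ := norm_pos_iff.2 h
  have h0 := norm_mul_norm_le_sq hv 0
  have h1 := norm_mul_norm_le_sq hv 1
  have h2 := re_trace_Apoint_three_vecMulVec 0 2 v ▸ hv (0, 2)
  simp only [show (0 : ZMod 3) + 1 = 1 from rfl, show (0 : ZMod 3) - 1 = 2 from rfl,
    show (1 : ZMod 3) + 1 = 2 from rfl, show (1 : ZMod 3) - 1 = 0 from rfl,
    show (2 : ZMod 3) + 1 = 0 from rfl, show (2 : ZMod 3) - 1 = 1 from rfl,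
    ZMod.val_zero, pow_zero, one_mul] at h0 h1 h2
  have hc : ‖v 2‖ ≤ ‖v 0‖ := by
    have e1 : (‖v 1‖ * ‖v 2‖) ^ 2 ≤ (‖v 0‖ ^ 2) ^ 2 := by gcongr
    have e2 : ‖v 2‖ * ‖v 0‖ * ‖v 2‖ ^ 2 ≤ ‖v 1‖ ^ 2 * ‖v 2‖ ^ 2 := by gcongr
    have e3 : ‖v 0‖ * ‖v 2‖ ^ 3 ≤ ‖v 0‖ * ‖v 0‖ ^ 3 := by nlinarith
    exact le_of_pow_le_pow_left₀ three_ne_zero ha.le (le_of_mul_le_mul_left e3 ha)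
  have : ‖v 2‖ ^ 2 ≤ ‖v 0‖ ^ 2 := by gcongr
  linarith

end NonnegWigner

/-- A state with nonnegative Wigner function outside the stabilizer polytope: the even mixture of
`(|0⟩ - |1⟩) / √2` and `|2⟩`. -/
noncomputable def boundState : Matrix (ZMod 3) (ZMod 3) ℂ :=
  Matrix.vecMulVec (Pi.single 0 (1 / 2) - Pi.single 1 (1 / 2))
      (star (Pi.single 0 (1 / 2) - Pi.single 1 (1 / 2)))
    + Matrix.diagonal (Pi.single 2 (1 / 2))

open ComplexOrder in
lemma boundState_posSemidef : boundState.PosSemidef :=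
  (Matrix.posSemidef_vecMulVec_self_star _).add <|
    Matrix.PosSemidef.diagonal <| Pi.single_nonneg.2 (by norm_num [Complex.le_def])

lemma boundState_apply (x y : ZMod 3) : boundState x y =
    if x = 2 ∧ y = 2 then 1 / 2 else if x = 2 ∨ y = 2 then 0 else if x = y then 1 / 4
      else -1 / 4 := by
  obtain rfl | rfl | rfl : x = 0 ∨ x = 1 ∨ x = 2 := by decide +revert
  all_goals
    obtain rfl | rfl | rfl : y = 0 ∨ y = 1 ∨ y = 2 := by decide +revert
    all_goals
      norm_num +decide [boundState, Matrix.vecMulVec_apply, Matrix.diagonal_apply, Pi.single_apply]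

lemma boundState_wigner_nonneg (u : ZMod 3 × ZMod 3) :
    0 ≤ ((Apoint 3 u * boundState).trace).re := by
  obtain ⟨p, q⟩ := u
  have h4 : omegaC 3 ^ 4 = omegaC 3 := by rw [pow_succ, omegaC_three_cube, one_mul]
  have hval : (1 : ZMod 3).val = 1 ∧ (2 : ZMod 3).val = 2 := ⟨rfl, rfl⟩
  rw [trace_Apoint_three_mul]
  obtain rfl | rfl | rfl : q = 0 ∨ q = 1 ∨ q = 2 := by decide +revert
  · norm_num +decide [boundState_apply]
  · norm_num +decide [boundState_apply]
  · obtain rfl | rfl | rfl : p = 0 ∨ p = 1 ∨ p = 2 := by decide +revert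
    · norm_num +decide [boundState_apply]
    · norm_num +decide [boundState_apply, hval, omegaC_three_sq, omegaC_three_re]
    · norm_num +decide [boundState_apply, hval, h4, omegaC_three_sq, omegaC_three_re]

open ComplexOrder in
/-- Existence of bound universal states for the qutrit. -/
theorem bound_universal_state_qutrit :
    ∃ ρ : Matrix (ZMod 3) (ZMod 3) ℂ,
      ρ.PosSemidef ∧ ρ.trace = 1 ∧
      (∀ u : ZMod 3 × ZMod 3, 0 ≤ ((Apoint 3 u * ρ).trace).re) ∧
      ρ ∉ convexHull ℝ { P : Matrix (ZMod 3) (ZMod 3) ℂ |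
          ∃ v : ZMod 3 → ℂ, (∑ x : ZMod 3, ‖v x‖ ^ 2) = 1 ∧
            P = Matrix.vecMulVec v (star v) ∧
            ∀ w : ZMod 3 × ZMod 3, 0 ≤ ((Apoint 3 w * P).trace).re } := by
  refine ⟨boundState, boundState_posSemidef, ?_, boundState_wigner_nonneg, fun hρ => ?_⟩
  · norm_num +decide [Matrix.trace, sum_zmod_three, boundState_apply]
  · have hconv : Convex ℝ {P : Matrix (ZMod 3) (ZMod 3) ℂ | 0 ≤ (P 0 0).re + 2 * (P 0 1).re} := by
      intro P hP Q hQ a b ha hb _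
      simp only [Set.mem_ofPred_eq, Matrix.add_apply, Matrix.smul_apply, Complex.add_re,
        Complex.smul_re, smul_eq_mul] at hP hQ ⊢
      nlinarith [mul_nonneg ha hP, mul_nonneg hb hQ]
    have hmem := convexHull_min (fun P hP => ?_) hconv hρ
    · norm_num +decide [boundState_apply] at hmem
    · obtain ⟨v, -, rfl, hv⟩ := hP
      have h := witness_nonneg hv
      rwa [← Complex.normSq_eq_norm_sq, ← Complex.ofReal_re (Complex.normSq (v 0)),
        ← Complex.mul_conj] at h
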